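/- arXiv:0908.2604 — 5 statements merged into one kernel-verified Lean document; each statement's English description precedes it below -/
import Mathlib

section
/- Assume that μ is an isomorphism. Then: (i) M = Tξ; (ii) ξ is nonzero and {ξ} is a basis for the F-vector space e*_0 M. -/
open Polynomial

noncomputable section

/-- The polynomial `τ_i = (λ−θ_0)(λ−θ_1)⋯(λ−θ_{i−1})`. -/
def tauPoly {F : Type*} [Field F] (θ : ℕ → F) (i : ℕ) : Polynomial F :=
  ∏ j ∈ Finset.range i, (X - C (θ j))

/-- The polynomial `η_i = (λ−θ_d)(λ−θ_{d−1})⋯(λ−θ_{d−i+1})`. -/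
def etaPoly {F : Type*} [Field F] (d : ℕ) (θ : ℕ → F) (i : ℕ) : Polynomial F :=
  ∏ j ∈ Finset.range i, (X - C (θ (d - j)))

/-- Generators of the algebra `T`: `a`, `a*`, `e_0,…,e_d`, `e*_0,…,e*_d`. -/
inductive TGen (d : ℕ) : Type
  | a : TGen d
  | astar : TGen d
  | e : Fin (d + 1) → TGen d
  | estar : Fin (d + 1) → TGen d

/-- The defining relations of the algebra `T`. -/
inductive TRel (F : Type*) [Field F] (d : ℕ) (θ θs : ℕ → F) :
    FreeAlgebra F (TGen d) → FreeAlgebra F (TGen d) → Prop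
  | ee (i j : Fin (d + 1)) :
      TRel F d θ θs (FreeAlgebra.ι F (TGen.e i) * FreeAlgebra.ι F (TGen.e j))
        (if i = j then FreeAlgebra.ι F (TGen.e i) else 0)
  | eses (i j : Fin (d + 1)) :
      TRel F d θ θs (FreeAlgebra.ι F (TGen.estar i) * FreeAlgebra.ι F (TGen.estar j))
        (if i = j then FreeAlgebra.ι F (TGen.estar i) else 0)
  | sum_e : TRel F d θ θs (∑ i : Fin (d + 1), FreeAlgebra.ι F (TGen.e i)) 1
  | sum_estar : TRel F d θ θs (∑ i : Fin (d + 1), FreeAlgebra.ι F (TGen.estar i)) 1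
  | a_eq : TRel F d θ θs (FreeAlgebra.ι F TGen.a)
      (∑ i : Fin (d + 1), θ (i : ℕ) • FreeAlgebra.ι F (TGen.e i))
  | astar_eq : TRel F d θ θs (FreeAlgebra.ι F TGen.astar)
      (∑ i : Fin (d + 1), θs (i : ℕ) • FreeAlgebra.ι F (TGen.estar i))
  | trid (i j : Fin (d + 1)) (k : ℕ) (hk : k ≤ d)
      (h : k < max ((i : ℕ) - (j : ℕ)) ((j : ℕ) - (i : ℕ))) :
      TRel F d θ θs (FreeAlgebra.ι F (TGen.estar i) * FreeAlgebra.ι F TGen.a ^ k *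
        FreeAlgebra.ι F (TGen.estar j)) 0
  | tridstar (i j : Fin (d + 1)) (k : ℕ) (hk : k ≤ d)
      (h : k < max ((i : ℕ) - (j : ℕ)) ((j : ℕ) - (i : ℕ))) :
      TRel F d θ θs (FreeAlgebra.ι F (TGen.e i) * FreeAlgebra.ι F TGen.astar ^ k *
        FreeAlgebra.ι F (TGen.e j)) 0

/-- The `F`-algebra `T` presented by the above generators and relations. -/
abbrev TAlg (F : Type*) [Field F] (d : ℕ) (θ θs : ℕ → F) : Type _ :=
  RingQuot (TRel F d θ θs)

/-- The image in `T` of a generator. -/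
def tgen (F : Type*) [Field F] (d : ℕ) (θ θs : ℕ → F) (g : TGen d) : TAlg F d θ θs :=
  RingQuot.mkAlgHom F (TRel F d θ θs) (FreeAlgebra.ι F g)

/-- The element `a` of `T`. -/
def aT (F : Type*) [Field F] (d : ℕ) (θ θs : ℕ → F) : TAlg F d θ θs :=
  tgen F d θ θs TGen.a

/-- The element `a*` of `T`. -/
def asT (F : Type*) [Field F] (d : ℕ) (θ θs : ℕ → F) : TAlg F d θ θs :=
  tgen F d θ θs TGen.astar

/-- The element `e_i` of `T` (defined to be `0` for `i > d`). -/
def eT (F : Type*) [Field F] (d : ℕ) (θ θs : ℕ → F) (i : ℕ) : TAlg F d θ θs :=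
  if h : i < d + 1 then tgen F d θ θs (TGen.e ⟨i, h⟩) else 0

/-- The element `e*_i` of `T` (defined to be `0` for `i > d`). -/
def esT (F : Type*) [Field F] (d : ℕ) (θ θs : ℕ → F) (i : ℕ) : TAlg F d θ θs :=
  if h : i < d + 1 then tgen F d θ θs (TGen.estar ⟨i, h⟩) else 0

/-- Conditions (i) and (iii): the `θ_i` are mutually distinct, the `θ*_i` are mutually
distinct, and the expressions `(θ_{i-2}−θ_{i+1})/(θ_{i-1}−θ_i)`,
`(θ*_{i-2}−θ*_{i+1})/(θ*_{i-1}−θ*_i)` are equal and independent of `i` for `2 ≤ i ≤ d−1`. -/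
def EigCond (F : Type*) [Field F] (d : ℕ) (θ θs : ℕ → F) : Prop :=
  (∀ i j, i ≤ d → j ≤ d → i ≠ j → θ i ≠ θ j) ∧
  (∀ i j, i ≤ d → j ≤ d → i ≠ j → θs i ≠ θs j) ∧
  ∃ β : F, ∀ i, 2 ≤ i → i + 1 ≤ d →
    θ (i - 2) - θ (i + 1) = β * (θ (i - 1) - θ i) ∧
    θs (i - 2) - θs (i + 1) = β * (θs (i - 1) - θs i)

/-- The subalgebra `D` of `T` generated by `a`, as an `F`-subspace. -/
def Dsub (F : Type*) [Field F] (d : ℕ) (θ θs : ℕ → F) : Submodule F (TAlg F d θ θs) :=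
  Subalgebra.toSubmodule (Algebra.adjoin F {aT F d θ θs})

/-- The subalgebra `D*` of `T` generated by `a*`, as an `F`-subspace. -/
def DsSub (F : Type*) [Field F] (d : ℕ) (θ θs : ℕ → F) : Submodule F (TAlg F d θ θs) :=
  Subalgebra.toSubmodule (Algebra.adjoin F {asT F d θ θs})

end

noncomputable section

/-- A tridiagonal system on `V` of diameter `d`, with data `(A; {E_i}; A*; {E*_i})`,
eigenvalue sequence `θ` and dual eigenvalue sequence `θs`.  The families `E`, `Es` are the
orderings of the primitive idempotents of `A`, `A*` (so the `E_i V` are the eigenspaces of the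
diagonalizable map `A`, ordered so that the tridiagonal conditions hold, and similarly for
`A*`), and the last condition is the irreducibility condition (iv). -/
def IsTDSystem (F : Type*) [Field F] (V : Type*) [AddCommGroup V] [Module F V]
    (d : ℕ) (A As : V →ₗ[F] V) (E Es : ℕ → (V →ₗ[F] V)) (θ θs : ℕ → F) : Prop :=
  FiniteDimensional F V ∧ 0 < Module.finrank F V ∧
  (∀ i j, i ≤ d → j ≤ d → i ≠ j → θ i ≠ θ j) ∧
  (∀ i j, i ≤ d → j ≤ d → i ≠ j → θs i ≠ θs j) ∧
  (∀ i, i ≤ d → E i ≠ 0) ∧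
  (∀ i, i ≤ d → Es i ≠ 0) ∧
  (∀ i j, i ≤ d → j ≤ d → E i ∘ₗ E j = if i = j then E i else 0) ∧
  (∀ i j, i ≤ d → j ≤ d → Es i ∘ₗ Es j = if i = j then Es i else 0) ∧
  (∑ i ∈ Finset.range (d + 1), E i) = LinearMap.id ∧
  (∑ i ∈ Finset.range (d + 1), Es i) = LinearMap.id ∧
  A = ∑ i ∈ Finset.range (d + 1), θ i • E i ∧
  As = ∑ i ∈ Finset.range (d + 1), θs i • Es i ∧
  (∀ i, i ≤ d → Submodule.map As (LinearMap.range (E i)) ≤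
    (if i = 0 then ⊥ else LinearMap.range (E (i - 1))) ⊔ LinearMap.range (E i) ⊔
      (if i = d then ⊥ else LinearMap.range (E (i + 1)))) ∧
  (∀ i, i ≤ d → Submodule.map A (LinearMap.range (Es i)) ≤
    (if i = 0 then ⊥ else LinearMap.range (Es (i - 1))) ⊔ LinearMap.range (Es i) ⊔
      (if i = d then ⊥ else LinearMap.range (Es (i + 1)))) ∧
  (∀ W : Submodule F V, (∀ w ∈ W, A w ∈ W) → (∀ w ∈ W, As w ∈ W) → W = ⊥ ∨ W = ⊤)

/-- A sharp tridiagonal system with parameter array `(θ; θs; ζ)`:  a tridiagonal system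
which is sharp (`dim E*_0 V = 1`) and whose split sequence is `ζ`, i.e.
`E*_0 τ_i(A) E*_0 = ζ_i E*_0 / ((θ*_0−θ*_1)⋯(θ*_0−θ*_i))` for `0 ≤ i ≤ d`. -/
def SharpTDWithArray (F : Type*) [Field F] (V : Type*) [AddCommGroup V] [Module F V]
    (d : ℕ) (A As : V →ₗ[F] V) (E Es : ℕ → (V →ₗ[F] V)) (θ θs ζ : ℕ → F) : Prop :=
  IsTDSystem F V d A As E Es θ θs ∧
  Module.finrank F (LinearMap.range (Es 0)) = 1 ∧
  ∀ i, i ≤ d → Es 0 ∘ₗ (Polynomial.aeval A (tauPoly θ i)) ∘ₗ Es 0 =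
    (ζ i / ∏ h ∈ Finset.Icc 1 i, (θs 0 - θs h)) • Es 0

/-- The action of an element `x` of `T` on a `T`-module `M`, as an `F`-linear map. -/
def actL {F : Type*} [Field F] {d : ℕ} {θ θs : ℕ → F} {M : Type*} [AddCommGroup M]
    [Module F M] [Module (TAlg F d θ θs) M] [IsScalarTower F (TAlg F d θ θs) M]
    (x : TAlg F d θ θs) : M →ₗ[F] M where
  toFun m := x • m
  map_add' := smul_add x
  map_smul' c m := (smul_comm c x m).symm

/-- The `F`-linear map `T → M`, `t ↦ t • v`, for a vector `v` of a `T`-module `M`. -/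
def applyVec {F : Type*} [Field F] {d : ℕ} {θ θs : ℕ → F} {M : Type*} [AddCommGroup M]
    [Module F M] [Module (TAlg F d θ θs) M] [IsScalarTower F (TAlg F d θ θs) M]
    (v : M) : TAlg F d θ θs →ₗ[F] M where
  toFun t := t • v
  map_add' x y := add_smul x y v
  map_smul' c t := smul_assoc c t v

/-- The `F`-subspace `e*_0 T e*_0` of `T`. -/
def corner (F : Type*) [Field F] (d : ℕ) (θ θs : ℕ → F) : Submodule F (TAlg F d θ θs) :=
  LinearMap.range ((LinearMap.mulLeft F (esT F d θ θs 0)).comp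
    (LinearMap.mulRight F (esT F d θ θs 0)))

/-- The properties characterizing the homomorphism `μ : F[x_1,…,x_d] → e*_0 T e*_0`:
it is `F`-linear, unital (with `1 ↦ e*_0`, the identity of `e*_0Te*_0`), multiplicative,
sends `x_i ↦ e*_0 τ_i(a) e*_0` for `1 ≤ i ≤ d`, and is onto `e*_0 T e*_0`. -/
def MuProps (F : Type*) [Field F] (d : ℕ) (θ θs : ℕ → F)
    (μ : MvPolynomial (Fin d) F →ₗ[F] TAlg F d θ θs) : Prop :=
  μ 1 = esT F d θ θs 0 ∧
  (∀ p q, μ (p * q) = μ p * μ q) ∧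
  (∀ i : Fin d, μ (MvPolynomial.X i) =
    esT F d θ θs 0 * (Polynomial.aeval (aT F d θ θs) (tauPoly θ ((i : ℕ) + 1))) *
      esT F d θ θs 0) ∧
  LinearMap.range μ = corner F d θ θs

/-- Conditions (ii) on the split sequence: `ζ_0 = 1`, `ζ_d ≠ 0` and
`Σ_{i=0}^d η_{d−i}(θ_0) η*_{d−i}(θ*_0) ζ_i ≠ 0`. -/
def ZetaCond (F : Type*) [Field F] (d : ℕ) (θ θs : ℕ → F) (ζ : ℕ → F) : Prop :=
  ζ 0 = 1 ∧ ζ d ≠ 0 ∧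
  (∑ i ∈ Finset.range (d + 1),
    (etaPoly d θ (d - i)).eval (θ 0) * (etaPoly d θs (d - i)).eval (θs 0) * ζ i) ≠ 0

/-- The element `g_i = e*_0 τ_i(a) e*_0 − ζ_i e*_0/((θ*_0−θ*_1)⋯(θ*_0−θ*_i))` of `T`. -/
def gElt (F : Type*) [Field F] (d : ℕ) (θ θs : ℕ → F) (ζ : ℕ → F) (i : ℕ) :
    TAlg F d θ θs :=
  esT F d θ θs 0 * (Polynomial.aeval (aT F d θ θs) (tauPoly θ i)) * esT F d θ θs 0 -
    (ζ i / ∏ h ∈ Finset.Icc 1 i, (θs 0 - θs h)) • esT F d θ θs 0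

/-- The left ideal `J = T(1−e*_0) + Σ_{i=1}^d T g_i` of `T`, as a submodule of `T` over
itself (with the left regular action). -/
def Jideal (F : Type*) [Field F] (d : ℕ) (θ θs : ℕ → F) (ζ : ℕ → F) :
    Submodule (TAlg F d θ θs) (TAlg F d θ θs) :=
  Submodule.span (TAlg F d θ θs)
    ({1 - esT F d θ θs 0} ∪ (gElt F d θ θs ζ '' Set.Icc 1 d))

/-- The `F`-subspace `D D* D D* D ⋯ D D* D` of `T` with `n+1` factors `D`. -/
def DDchain (F : Type*) [Field F] (d : ℕ) (θ θs : ℕ → F) : ℕ → Submodule F (TAlg F d θ θs)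
  | 0 => Dsub F d θ θs
  | n + 1 => DDchain F d θ θs n * DsSub F d θ θs * Dsub F d θ θs

/-- The `F`-subspace `e*_r D e*_{κ 1} D e*_{κ 2} ⋯ D e*_{κ m}` of `T`. -/
def esChain (F : Type*) [Field F] (d : ℕ) (θ θs : ℕ → F) (r : ℕ) (κ : ℕ → ℕ) :
    ℕ → Submodule F (TAlg F d θ θs)
  | 0 => Submodule.span F {esT F d θ θs r}
  | m + 1 => esChain F d θ θs r κ m * Dsub F d θ θs *
      Submodule.span F {esT F d θ θs (κ (m + 1))}

/-- The sequence `(c_0, c_1, …, c_m)` is convex: `c_{i−1} − c_i ≥ c_i − c_{i+1}`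
for `1 ≤ i ≤ m−1`. -/
def ConvexSeq (c : ℕ → ℤ) (m : ℕ) : Prop :=
  ∀ i, 1 ≤ i → i + 1 ≤ m → c i - c (i + 1) ≤ c (i - 1) - c i

end

noncomputable section

/-- The scalar by which `e*_0 τ_{i+1}(a) e*_0` acts on `ξ`. -/
def splitScalar {F : Type*} [Field F] (d : ℕ) (θs ζ : ℕ → F) (i : Fin d) : F :=
  ζ ((i : ℕ) + 1) / ∏ h ∈ Finset.Icc 1 ((i : ℕ) + 1), (θs 0 - θs h)

end

section

variable {F : Type*} [Field F] {d : ℕ} {θ θs : ℕ → F}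
  {μ : MvPolynomial (Fin d) F →ₗ[F] TAlg F d θ θs}

lemma MuProps.map_C (hμ : MuProps F d θ θs μ) (c : F) :
    μ (MvPolynomial.C c) = c • esT F d θ θs 0 := by
  rw [← hμ.1, ← map_smul, MvPolynomial.smul_eq_C_mul, mul_one]

lemma MuProps.esT_zero_mul_self (hμ : MuProps F d θ θs μ) :
    esT F d θ θs 0 * esT F d θ θs 0 = esT F d θ θs 0 := by
  rw [← hμ.1, ← hμ.2.1, mul_one]

lemma MuProps.map_mul_esT_zero (hμ : MuProps F d θ θs μ) (p : MvPolynomial (Fin d) F) :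
    μ p * esT F d θ θs 0 = μ p := by
  rw [← hμ.1, ← hμ.2.1, mul_one]

lemma MuProps.map_X_sub_C (hμ : MuProps F d θ θs μ) (ζ : ℕ → F) (i : Fin d) :
    μ (MvPolynomial.X i - MvPolynomial.C (splitScalar d θs ζ i)) =
      gElt F d θ θs ζ ((i : ℕ) + 1) := by
  rw [map_sub, hμ.map_C, hμ.2.2.1]
  rfl

lemma MuProps.exists_map_eq (hμ : MuProps F d θ θs μ) (t : TAlg F d θ θs) :
    ∃ p, μ p = esT F d θ θs 0 * (t * esT F d θ θs 0) := by
  have ht : esT F d θ θs 0 * (t * esT F d θ θs 0) ∈ LinearMap.range μ := by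
    rw [hμ.2.2.2]
    exact ⟨t, rfl⟩
  exact ht

lemma one_sub_esT_zero_mem_Jideal (ζ : ℕ → F) :
    1 - esT F d θ θs 0 ∈ Jideal F d θ θs ζ :=
  Submodule.subset_span (Or.inl rfl)

lemma gElt_mem_Jideal (ζ : ℕ → F) (i : Fin d) :
    gElt F d θ θs ζ ((i : ℕ) + 1) ∈ Jideal F d θ θs ζ :=
  Submodule.subset_span (Or.inr ⟨_, ⟨Nat.le_add_left 1 _, i.isLt⟩, rfl⟩)

lemma mul_mem_Jideal {ζ : ℕ → F} (t : TAlg F d θ θs) {x : TAlg F d θ θs}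
    (hx : x ∈ Jideal F d θ θs ζ) : t * x ∈ Jideal F d θ θs ζ :=
  Submodule.smul_mem _ t hx

/-- Modulo `J`, an element `μ p` of `e*_0 T e*_0` is the scalar `p(ζ)`. -/
lemma MuProps.map_sub_eval_mem_Jideal (hμ : MuProps F d θ θs μ) (ζ : ℕ → F)
    (p : MvPolynomial (Fin d) F) :
    μ p - MvPolynomial.eval (splitScalar d θs ζ) p • 1 ∈ Jideal F d θ θs ζ := by
  induction p using MvPolynomial.induction_on with
  | C c =>
    rw [hμ.map_C, MvPolynomial.eval_C]
    have key : c • esT F d θ θs 0 - c • 1 = -(c • (1 - esT F d θ θs 0)) := by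
      rw [smul_sub, neg_sub]
    exact key ▸ neg_mem (Submodule.smul_of_tower_mem _ c (one_sub_esT_zero_mem_Jideal ζ))
  | add p q hp hq =>
    rw [map_add, map_add, add_smul, add_sub_add_comm]
    exact add_mem hp hq
  | mul_X p i hp =>
    have key : μ (p * MvPolynomial.X i) -
        MvPolynomial.eval (splitScalar d θs ζ) (p * MvPolynomial.X i) • 1 =
        μ p * gElt F d θ θs ζ ((i : ℕ) + 1) + splitScalar d θs ζ i •
          (μ p - MvPolynomial.eval (splitScalar d θs ζ) p • 1) := by
      rw [← hμ.map_X_sub_C, map_sub, hμ.map_C, mul_sub, mul_smul_comm, hμ.map_mul_esT_zero,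
        hμ.2.1, smul_sub, smul_smul, map_mul, MvPolynomial.eval_X, mul_comm (splitScalar d θs ζ i)]
      abel
    rw [key]
    exact add_mem (mul_mem_Jideal _ (gElt_mem_Jideal ζ i)) (Submodule.smul_of_tower_mem _ _ hp)

/-- `e*_0 J e*_0` lies in the image under `μ` of the maximal ideal of the point `ζ`. -/
lemma MuProps.exists_eval_eq_zero_of_mem_Jideal (hμ : MuProps F d θ θs μ) {ζ : ℕ → F}
    {x : TAlg F d θ θs} (hx : x ∈ Jideal F d θ θs ζ) (t : TAlg F d θ θs) :
    ∃ p, MvPolynomial.eval (splitScalar d θs ζ) p = 0 ∧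
      μ p = esT F d θ θs 0 * (t * x) * esT F d θ θs 0 := by
  induction hx using Submodule.span_induction generalizing t with
  | mem x hx =>
    rcases hx with rfl | ⟨n, ⟨h1, hn⟩, rfl⟩
    · refine ⟨0, map_zero _, ?_⟩
      rw [map_zero, mul_assoc, mul_assoc, sub_mul, hμ.esT_zero_mul_self, one_mul, sub_self,
        mul_zero, mul_zero]
    · obtain ⟨i, rfl⟩ : ∃ i : Fin d, n = (i : ℕ) + 1 := ⟨⟨n - 1, by omega⟩, by simp; omega⟩
      obtain ⟨q, hq⟩ := hμ.exists_map_eq t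
      refine ⟨q * (MvPolynomial.X i - MvPolynomial.C (splitScalar d θs ζ i)), by simp, ?_⟩
      have hl : esT F d θ θs 0 * gElt F d θ θs ζ ((i : ℕ) + 1) =
          gElt F d θ θs ζ ((i : ℕ) + 1) := by
        rw [← hμ.map_X_sub_C, ← hμ.1, ← hμ.2.1, one_mul]
      have hr : gElt F d θ θs ζ ((i : ℕ) + 1) * esT F d θ θs 0 =
          gElt F d θ θs ζ ((i : ℕ) + 1) := by
        rw [← hμ.map_X_sub_C, hμ.map_mul_esT_zero]
      rw [hμ.2.1, hq, hμ.map_X_sub_C, mul_assoc, mul_assoc, hl, mul_assoc, mul_assoc, hr]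
  | zero => exact ⟨0, map_zero _, by simp⟩
  | add x y _ _ hx hy =>
    obtain ⟨p, hp, hp'⟩ := hx t
    obtain ⟨q, hq, hq'⟩ := hy t
    exact ⟨p + q, by rw [map_add, hp, hq, add_zero],
      by rw [map_add, hp', hq', mul_add, mul_add, add_mul]⟩
  | smul s x _ hx =>
    obtain ⟨p, hp, hp'⟩ := hx (t * s)
    exact ⟨p, hp, by rw [hp', smul_eq_mul, mul_assoc t]⟩

lemma MuProps.one_notMem_Jideal (hμ : MuProps F d θ θs μ) (hinj : Function.Injective μ)
    (ζ : ℕ → F) : (1 : TAlg F d θ θs) ∉ Jideal F d θ θs ζ := by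
  intro h1
  obtain ⟨p, hp, hp'⟩ := hμ.exists_eval_eq_zero_of_mem_Jideal h1 1
  rw [mul_one, mul_one, hμ.esT_zero_mul_self, ← hμ.1] at hp'
  rw [hinj hp', map_one] at hp
  exact one_ne_zero hp

end

/-- If `μ` is an isomorphism then for the `T`-module `M = T/J` and `ξ = 1 + J`:
(i) `M = Tξ`; (ii) `ξ` is nonzero and `{ξ}` is a basis of the `F`-vector space `e*_0 M`. -/
theorem stmt9 {F : Type*} [Field F] (d : ℕ) (θ θs : ℕ → F) (h : EigCond F d θ θs)
    (μ : MvPolynomial (Fin d) F →ₗ[F] TAlg F d θ θs) (hμ : MuProps F d θ θs μ)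
    (hinj : Function.Injective μ)
    (ζ : ℕ → F) (hζ : ZetaCond F d θ θs ζ) :
    (⊤ : Submodule (TAlg F d θ θs) (TAlg F d θ θs ⧸ Jideal F d θ θs ζ)) =
      Submodule.span (TAlg F d θ θs) {Submodule.Quotient.mk (1 : TAlg F d θ θs)} ∧
    (Submodule.Quotient.mk (1 : TAlg F d θ θs) :
      TAlg F d θ θs ⧸ Jideal F d θ θs ζ) ≠ 0 ∧
    LinearMap.range (actL (M := TAlg F d θ θs ⧸ Jideal F d θ θs ζ) (esT F d θ θs 0)) =
      Submodule.span F {(Submodule.Quotient.mk (1 : TAlg F d θ θs) :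
        TAlg F d θ θs ⧸ Jideal F d θ θs ζ)} := by
  refine ⟨?_, ?_, le_antisymm ?_ ?_⟩
  · refine (Submodule.eq_top_iff'.2 fun m => ?_).symm
    obtain ⟨t, rfl⟩ := Submodule.Quotient.mk_surjective _ m
    exact Submodule.mem_span_singleton.2
      ⟨t, by rw [← Submodule.Quotient.mk_smul, smul_eq_mul, mul_one]⟩
  · rw [Ne, Submodule.Quotient.mk_eq_zero]
    exact hμ.one_notMem_Jideal hinj ζ
  · rintro _ ⟨m, rfl⟩
    obtain ⟨t, rfl⟩ := Submodule.Quotient.mk_surjective _ m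
    obtain ⟨p, hp⟩ := hμ.exists_map_eq t
    refine Submodule.mem_span_singleton.2 ⟨MvPolynomial.eval (splitScalar d θs ζ) p, ?_⟩
    change _ = Submodule.Quotient.mk (esT F d θ θs 0 * t)
    rw [← Submodule.Quotient.mk_smul, eq_comm, Submodule.Quotient.eq]
    have key := add_mem (hμ.map_sub_eval_mem_Jideal ζ p)
      (mul_mem_Jideal (esT F d θ θs 0 * t) (one_sub_esT_zero_mem_Jideal ζ))
    convert key using 1
    rw [hp, mul_sub, mul_one, mul_assoc]
    abel
  · rw [Submodule.span_singleton_le_iff_mem]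
    refine ⟨Submodule.Quotient.mk 1, ?_⟩
    change Submodule.Quotient.mk (esT F d θ θs 0 * 1) = _
    rw [mul_one, eq_comm, Submodule.Quotient.eq]
    exact one_sub_esT_zero_mem_Jideal ζ
end

section
/- Assume that μ is an isomorphism. For 1 ≤ r ≤ d, the F-vector space e*_r M is equal to the sum Σ e*_r D e*_{k_1} D e*_{k_2} ⋯ D e*_{k_m} D ξ, where the sum is over all sequences (k_1, k_2, …, k_m) with m ≥ 0 such that r > k_1 > k_2 > ⋯ > k_m > 0 and the sequence (r, k_1, k_2, …, k_m, 0) is convex. -/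
open Polynomial

/-- Vandermonde nondegeneracy for module-valued weights: if the power moments of the weights
`v j` at the distinct nodes `x j` vanish up to the number of nodes, then every weight vanishes. -/
theorem eq_zero_of_moments {F Q : Type*} [Field F] [AddCommGroup Q] [Module F Q]
    {s u : Finset ℕ} (hsu : s ⊆ u) {x : ℕ → F} (hx : Set.InjOn x s) {v : ℕ → Q}
    (hv : ∀ j ∈ u, j ∉ s → v j = 0)
    (hm : ∀ t < s.card, ∑ j ∈ u, x j ^ t • v j = 0) : ∀ j ∈ u, v j = 0 := by
  have hm' : ∀ t < s.card, ∑ j ∈ s, x j ^ t • v j = 0 := fun t ht => by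
    rw [← hm t ht]
    exact Finset.sum_subset hsu fun j hj hjs => by rw [hv j hj hjs, smul_zero]
  have key : ∀ p : F[X], p.natDegree < s.card → ∑ j ∈ s, p.eval (x j) • v j = 0 := by
    intro p hp
    simp_rw [eval_eq_sum_range, Finset.sum_smul]
    rw [Finset.sum_comm]
    refine Finset.sum_eq_zero fun t ht => ?_
    simp_rw [mul_smul]
    rw [← Finset.smul_sum, hm' t (by rw [Finset.mem_range] at ht; omega), smul_zero]
  intro j hju
  by_cases hj : j ∈ s
  · have hcard : 0 < s.card := Finset.card_pos.2 ⟨j, hj⟩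
    have h1 := key (Lagrange.basis s x j) (by
      rw [natDegree_eq_of_degree_eq_some (Lagrange.degree_basis hx hj)]
      omega)
    rw [Finset.sum_eq_single_of_mem j hj, Lagrange.eval_basis_self hx hj, one_smul] at h1
    · exact h1
    · intro b hb hbj
      rw [Lagrange.eval_basis_of_ne hbj.symm hb, zero_smul]
  · exact hv j hju hj

/-- A band matrix of half-width `t` vanishes if its rows have `P` vanishing moments, its columns
have `Q'` vanishing moments, and `2 * t + 1 ≤ P + Q'`. -/
theorem band_eq_zero {F Q : Type*} [Field F] [AddCommGroup Q] [Module F Q]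
    {d t P Q' : ℕ} {θ : ℕ → F} (hθ : Set.InjOn θ (Finset.range (d + 1)))
    (hPQ : 2 * t + 1 ≤ P + Q') {Φ : ℕ → ℕ → Q}
    (hband : ∀ r ≤ d, ∀ s ≤ d, r + t < s ∨ s + t < r → Φ r s = 0)
    (hrow : ∀ r ≤ d, ∀ v < P, ∑ s ∈ Finset.range (d + 1), θ s ^ v • Φ r s = 0)
    (hcol : ∀ s ≤ d, ∀ u < Q', ∑ r ∈ Finset.range (d + 1), θ r ^ u • Φ r s = 0) :
    ∀ r ≤ d, ∀ s ≤ d, Φ r s = 0 := by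
  have peel : ∀ n, ∃ R C, R + C = n ∧ (∀ r ≤ d, ∀ s ≤ d, r < R ∨ s < C → Φ r s = 0) := by
    intro n
    induction n with
    | zero => exact ⟨0, 0, rfl, fun r _ s _ h => by omega⟩
    | succ n ih =>
      obtain ⟨R, C, hRC, hz⟩ := ih
      by_cases hcase : R + t + 1 ≤ P + C
      · refine ⟨R + 1, C, by omega, fun r hr s hs h => ?_⟩
        by_cases hlt : r < R ∨ s < C
        · exact hz r hr s hs hlt
        obtain rfl : r = R := by omega
        have hsub : Finset.range (d + 1) ∩ Finset.Ico C (r + t + 1) ⊆ Finset.range (d + 1) :=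
          Finset.inter_subset_left
        refine eq_zero_of_moments (v := fun s => Φ r s) hsub
          (hθ.mono (Finset.coe_subset.2 hsub)) ?_ ?_ s (by simp; omega)
        · intro j hj hj'
          simp only [Finset.mem_inter, Finset.mem_range, Finset.mem_Ico] at hj hj'
          by_cases hjC : j < C
          · exact hz r hr j (by omega) (Or.inr hjC)
          · exact hband r hr j (by omega) (by omega)
        · intro v hv
          refine hrow r hr v (hv.trans_le ?_)
          refine (Finset.card_le_card Finset.inter_subset_right).trans ?_
          rw [Nat.card_Ico]; omega
      · refine ⟨R, C + 1, by omega, fun r hr s hs h => ?_⟩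
        by_cases hlt : r < R ∨ s < C
        · exact hz r hr s hs hlt
        obtain rfl : s = C := by omega
        have hsub : Finset.range (d + 1) ∩ Finset.Ico R (s + t + 1) ⊆ Finset.range (d + 1) :=
          Finset.inter_subset_left
        refine eq_zero_of_moments (v := fun r => Φ r s) hsub
          (hθ.mono (Finset.coe_subset.2 hsub)) ?_ ?_ r (by simp; omega)
        · intro j hj hj'
          simp only [Finset.mem_inter, Finset.mem_range, Finset.mem_Ico] at hj hj'
          by_cases hjR : j < R
          · exact hz j (by omega) s hs (Or.inl hjR)
          · exact hband j (by omega) s hs (by omega)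
        · intro u hu
          refine hcol s hs u (hu.trans_le ?_)
          refine (Finset.card_le_card Finset.inter_subset_right).trans ?_
          rw [Nat.card_Ico]; omega
  intro r hr s hs
  obtain ⟨R, C, hRC, hz⟩ := peel (2 * d + 2)
  exact hz r hr s hs (by omega)

/-- An array `φ j r s` whose moments satisfy the triple tridiagonal vanishing conditions and which
vanishes for `j ≤ h` is identically zero, provided `i + k ≤ 2 * h + 1`. -/
theorem array_eq_zero {F Q : Type*} [Field F] [AddCommGroup Q] [Module F Q]
    {d h i k : ℕ} {θ θs : ℕ → F} (hθ : Set.InjOn θ (Finset.range (d + 1)))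
    (hθs : Set.InjOn θs (Finset.range (d + 1))) (hik : i + k ≤ 2 * h + 1)
    {φ : ℕ → ℕ → ℕ → Q} (hlow : ∀ j ≤ h, ∀ r s, φ j r s = 0)
    (hband : ∀ r ≤ d, ∀ s ≤ d, ∀ t, r + t < s ∨ s + t < r →
      ∑ j ∈ Finset.range (d + 1), θs j ^ t • φ j r s = 0)
    (hrow : ∀ j r v, k + v < j → ∑ s ∈ Finset.range (d + 1), θ s ^ v • φ j r s = 0)
    (hcol : ∀ j s u, i + u < j → ∑ r ∈ Finset.range (d + 1), θ r ^ u • φ j r s = 0) :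
    ∀ j ≤ d, ∀ r ≤ d, ∀ s ≤ d, φ j r s = 0 := by
  have moments : ∀ t, ∀ r ≤ d, ∀ s ≤ d,
      ∑ j ∈ Finset.range (d + 1), θs j ^ t • φ j r s = 0 := by
    intro t
    induction t using Nat.strong_induction_on with
    | _ t ih =>
    have vanish : ∀ (ψ : ℕ → Q), (∀ j, j ≤ h → ψ j = 0) → (∀ j, h + t < j → ψ j = 0) →
        (∀ t' < t, ∑ j ∈ Finset.range (d + 1), θs j ^ t' • ψ j = 0) →
        ∀ j ∈ Finset.range (d + 1), ψ j = 0 := by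
      intro ψ h1 h2 h3
      have hsub : Finset.range (d + 1) ∩ Finset.Ioc h (h + t) ⊆ Finset.range (d + 1) :=
        Finset.inter_subset_left
      refine eq_zero_of_moments hsub (hθs.mono (Finset.coe_subset.2 hsub)) ?_ ?_
      · intro j hj hj'
        simp only [Finset.mem_inter, hj, Finset.mem_Ioc, true_and, not_and, not_le] at hj'
        by_cases hjh : j ≤ h
        · exact h1 j hjh
        · exact h2 j (hj' (by omega))
      · intro t' ht'
        refine h3 t' (ht'.trans_le ?_)
        refine (Finset.card_le_card Finset.inter_subset_right).trans ?_
        rw [Nat.card_Ioc]; omega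
    refine band_eq_zero hθ (P := t + h + 1 - k) (Q' := t + h + 1 - i) (t := t) (by omega)
      (fun r hr s hs => hband r hr s hs t) ?_ ?_
    · intro r hr v hv
      simp_rw [Finset.smul_sum]
      rw [Finset.sum_comm]
      refine Finset.sum_eq_zero fun j hj => ?_
      simp_rw [smul_comm _ (θs j ^ t)]
      rw [← Finset.smul_sum,
        vanish (fun j => ∑ s ∈ Finset.range (d + 1), θ s ^ v • φ j r s) ?_ ?_ ?_ j hj, smul_zero]
      · exact fun j hj => Finset.sum_eq_zero fun s _ => by rw [hlow j hj, smul_zero]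
      · exact fun j hj => hrow j r v (by omega)
      · intro t' ht'
        simp_rw [Finset.smul_sum]
        rw [Finset.sum_comm]
        refine Finset.sum_eq_zero fun s hs => ?_
        simp_rw [smul_comm _ (θ s ^ v)]
        rw [← Finset.smul_sum, ih t' ht' r hr s (Finset.mem_range_succ_iff.1 hs), smul_zero]
    · intro s hs u hu
      simp_rw [Finset.smul_sum]
      rw [Finset.sum_comm]
      refine Finset.sum_eq_zero fun j hj => ?_
      simp_rw [smul_comm _ (θs j ^ t)]
      rw [← Finset.smul_sum,
        vanish (fun j => ∑ r ∈ Finset.range (d + 1), θ r ^ u • φ j r s) ?_ ?_ ?_ j hj, smul_zero]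
      · exact fun j hj => Finset.sum_eq_zero fun r _ => by rw [hlow j hj, smul_zero]
      · exact fun j hj => hcol j s u (by omega)
      · intro t' ht'
        simp_rw [Finset.smul_sum]
        rw [Finset.sum_comm]
        refine Finset.sum_eq_zero fun r hr => ?_
        simp_rw [smul_comm _ (θ r ^ u)]
        rw [← Finset.smul_sum, ih t' ht' r (Finset.mem_range_succ_iff.1 hr) s hs, smul_zero]
  intro j hj r hr s hs
  exact eq_zero_of_moments (v := fun j => φ j r s) subset_rfl hθs
    (fun j hj hj' => absurd hj hj') (fun t _ => moments t r hr s hs) j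
    (Finset.mem_range_succ_iff.2 hj)

section TAlgRelations

variable {F : Type*} [Field F] {d : ℕ} {θ θs : ℕ → F}

/-- A polynomial in `∑ c i • e i` for complete orthogonal idempotents `e i`. -/
theorem aeval_sum_idempotents {A : Type*} [Ring A] [Algebra F A] {e : ℕ → A} {c : ℕ → F}
    {s : Finset ℕ} (hmul : ∀ i j, e i * e j = if i = j then e i else 0)
    (hsum : ∑ i ∈ s, e i = 1) (f : F[X]) :
    aeval (∑ i ∈ s, c i • e i) f = ∑ i ∈ s, f.eval (c i) • e i := by
  induction f using Polynomial.induction_on' with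
  | add p q hp hq => simp [hp, hq, add_smul, Finset.sum_add_distrib]
  | monomial n b =>
    have hpow : (∑ i ∈ s, c i • e i) ^ n = ∑ i ∈ s, c i ^ n • e i := by
      induction n with
      | zero => simp [hsum]
      | succ n ih =>
        rw [pow_succ, ih, Finset.sum_mul]
        refine Finset.sum_congr rfl fun i hi => ?_
        simp [Finset.mul_sum, hmul, hi, smul_smul, pow_succ, mul_comm]
    simp only [aeval_monomial, hpow, eval_monomial, Finset.mul_sum, mul_smul]
    refine Finset.sum_congr rfl fun i _ => ?_
    rw [Algebra.smul_def b]

theorem eT_mul (i j : ℕ) :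
    eT F d θ θs i * eT F d θ θs j = if i = j then eT F d θ θs i else 0 := by
  unfold eT
  by_cases hi : i < d + 1 <;> by_cases hj : j < d + 1
  · simp only [hi, hj, dif_pos, tgen]
    rw [← map_mul, RingQuot.mkAlgHom_rel F (TRel.ee ⟨i, hi⟩ ⟨j, hj⟩)]
    simp only [Fin.mk.injEq]
    split_ifs <;> simp
  all_goals simp [hi, hj]
  omega

theorem esT_mul (i j : ℕ) :
    esT F d θ θs i * esT F d θ θs j = if i = j then esT F d θ θs i else 0 := by
  unfold esT
  by_cases hi : i < d + 1 <;> by_cases hj : j < d + 1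
  · simp only [hi, hj, dif_pos, tgen]
    rw [← map_mul, RingQuot.mkAlgHom_rel F (TRel.eses ⟨i, hi⟩ ⟨j, hj⟩)]
    simp only [Fin.mk.injEq]
    split_ifs <;> simp
  all_goals simp [hi, hj]
  omega

theorem eT_fin (i : Fin (d + 1)) : eT F d θ θs i = tgen F d θ θs (TGen.e i) := by
  rw [eT, dif_pos i.isLt]

theorem esT_fin (i : Fin (d + 1)) : esT F d θ θs i = tgen F d θ θs (TGen.estar i) := by
  rw [esT, dif_pos i.isLt]

theorem sum_eT : ∑ i ∈ Finset.range (d + 1), eT F d θ θs i = 1 := by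
  rw [Finset.sum_range]
  simp_rw [eT_fin, tgen]
  rw [← map_sum, RingQuot.mkAlgHom_rel F TRel.sum_e, map_one]

theorem sum_esT : ∑ i ∈ Finset.range (d + 1), esT F d θ θs i = 1 := by
  rw [Finset.sum_range]
  simp_rw [esT_fin, tgen]
  rw [← map_sum, RingQuot.mkAlgHom_rel F TRel.sum_estar, map_one]

theorem aT_eq_sum : aT F d θ θs = ∑ i ∈ Finset.range (d + 1), θ i • eT F d θ θs i := by
  rw [Finset.sum_range]
  simp_rw [eT_fin, aT, tgen]
  rw [RingQuot.mkAlgHom_rel F TRel.a_eq, map_sum]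
  simp_rw [map_smul]

theorem asT_eq_sum : asT F d θ θs = ∑ i ∈ Finset.range (d + 1), θs i • esT F d θ θs i := by
  rw [Finset.sum_range]
  simp_rw [esT_fin, asT, tgen]
  rw [RingQuot.mkAlgHom_rel F TRel.astar_eq, map_sum]
  simp_rw [map_smul]

theorem aeval_aT (f : F[X]) :
    aeval (aT F d θ θs) f = ∑ i ∈ Finset.range (d + 1), f.eval (θ i) • eT F d θ θs i := by
  rw [aT_eq_sum, aeval_sum_idempotents eT_mul sum_eT]

theorem aT_pow (n : ℕ) :
    aT F d θ θs ^ n = ∑ i ∈ Finset.range (d + 1), θ i ^ n • eT F d θ θs i := by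
  simpa using aeval_aT (θ := θ) (θs := θs) (d := d) (X ^ n)

theorem asT_pow (n : ℕ) :
    asT F d θ θs ^ n = ∑ i ∈ Finset.range (d + 1), θs i ^ n • esT F d θ θs i := by
  have := aeval_sum_idempotents (c := θs) (esT_mul (F := F) (d := d) (θ := θ) (θs := θs))
    sum_esT (X ^ n)
  simpa [asT_eq_sum] using this

theorem esT_mul_pow_mul_esT {i j n : ℕ} (hn : i + n < j ∨ j + n < i) :
    esT F d θ θs i * aT F d θ θs ^ n * esT F d θ θs j = 0 := by
  by_cases hi : i < d + 1
  · by_cases hj : j < d + 1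
    · simp only [esT, aT, tgen, hi, hj, dif_pos]
      rw [← map_pow, ← map_mul, ← map_mul,
        RingQuot.mkAlgHom_rel F (TRel.trid ⟨i, hi⟩ ⟨j, hj⟩ n (by omega) (by simp only; omega)),
        map_zero]
    · simp [esT, hj]
  · simp [esT, hi]

theorem eT_mul_pow_mul_eT {i j n : ℕ} (hn : i + n < j ∨ j + n < i) :
    eT F d θ θs i * asT F d θ θs ^ n * eT F d θ θs j = 0 := by
  by_cases hi : i < d + 1
  · by_cases hj : j < d + 1
    · simp only [eT, asT, tgen, hi, hj, dif_pos]
      rw [← map_pow, ← map_mul, ← map_mul,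
        RingQuot.mkAlgHom_rel F (TRel.tridstar ⟨i, hi⟩ ⟨j, hj⟩ n (by omega) (by simp only; omega)),
        map_zero]
    · simp [eT, hj]
  · simp [eT, hi]

theorem eT_eq_aeval (hθ : Set.InjOn θ (Finset.range (d + 1))) (i : ℕ) :
    ∃ f : F[X], eT F d θ θs i = aeval (aT F d θ θs) f := by
  by_cases hi : i ∈ Finset.range (d + 1)
  · refine ⟨Lagrange.basis (Finset.range (d + 1)) θ i, ?_⟩
    rw [aeval_aT, Finset.sum_eq_single_of_mem i hi, Lagrange.eval_basis_self hθ hi, one_smul]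
    intro b hb hbi
    rw [Lagrange.eval_basis_of_ne hbi.symm hb, zero_smul]
  · exact ⟨0, by rw [Finset.mem_range] at hi; simp [eT, hi]⟩

theorem mem_Dsub {x : TAlg F d θ θs} :
    x ∈ Dsub F d θ θs ↔ ∃ f : F[X], aeval (aT F d θ θs) f = x := by
  rw [Dsub, Subalgebra.mem_toSubmodule, Algebra.adjoin_singleton_eq_range_aeval]
  rfl

/-- `e*_i D e*_j D e*_k` is contained in the sum of the spaces `e*_i D e*_{j'} D e*_k` with
`2 j' ≤ i + k`. -/
theorem esT_aeval_esT_aeval_esT_mem (hθ : Set.InjOn θ (Finset.range (d + 1)))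
    (hθs : Set.InjOn θs (Finset.range (d + 1))) (i j k : ℕ) (f g : F[X]) :
    esT F d θ θs i * aeval (aT F d θ θs) f * esT F d θ θs j * aeval (aT F d θ θs) g *
        esT F d θ θs k ∈
      Submodule.span F {x | ∃ (j' : ℕ) (f' g' : F[X]), 2 * j' ≤ i + k ∧
        x = esT F d θ θs i * aeval (aT F d θ θs) f' * esT F d θ θs j' *
          aeval (aT F d θ θs) g' * esT F d θ θs k} := by
  set S := Submodule.span F {x | ∃ (j' : ℕ) (f' g' : F[X]), 2 * j' ≤ i + k ∧
        x = esT F d θ θs i * aeval (aT F d θ θs) f' * esT F d θ θs j' *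
          aeval (aT F d θ θs) g' * esT F d θ θs k} with hS
  let w : ℕ → ℕ → ℕ → TAlg F d θ θs := fun j r s =>
    esT F d θ θs i * eT F d θ θs r * esT F d θ θs j * eT F d θ θs s * esT F d θ θs k
  have expand : ∀ j, esT F d θ θs i * aeval (aT F d θ θs) f * esT F d θ θs j *
      aeval (aT F d θ θs) g * esT F d θ θs k =
      ∑ r ∈ Finset.range (d + 1), ∑ s ∈ Finset.range (d + 1),
        (f.eval (θ r) * g.eval (θ s)) • w j r s := by
    intro j
    simp only [aeval_aT, Finset.mul_sum, Finset.sum_mul, w]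
    rw [Finset.sum_comm]
    simp only [mul_smul_comm, smul_mul_assoc, smul_smul, mul_comm]
  have hzero : ∀ j ≤ d, ∀ r ≤ d, ∀ s ≤ d, S.mkQ (w j r s) = 0 := by
    refine array_eq_zero (h := (i + k) / 2) (i := i) (k := k) hθ hθs (by omega)
      ?_ ?_ ?_ ?_
    · intro j hj r s
      rw [Submodule.mkQ_apply, Submodule.Quotient.mk_eq_zero]
      obtain ⟨f', hf'⟩ := eT_eq_aeval (θs := θs) hθ r
      obtain ⟨g', hg'⟩ := eT_eq_aeval (θs := θs) hθ s
      exact Submodule.subset_span ⟨j, f', g', by omega, by simp only [w, hf', hg']⟩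
    · intro r _ s _ t ht
      simp_rw [← map_smul]
      rw [← map_sum]
      convert map_zero S.mkQ
      have := congrArg (fun x => esT F d θ θs i * x * esT F d θ θs k)
        (eT_mul_pow_mul_eT (F := F) (d := d) (θ := θ) (θs := θs) ht)
      simpa [asT_pow, Finset.mul_sum, Finset.sum_mul, w, mul_assoc] using this
    · intro j r v hv
      simp_rw [← map_smul]
      rw [← map_sum]
      convert map_zero S.mkQ
      have := congrArg (fun x => esT F d θ θs i * eT F d θ θs r * x)
        (esT_mul_pow_mul_esT (F := F) (d := d) (θ := θ) (θs := θs) (Or.inr hv))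
      simpa [aT_pow, Finset.mul_sum, Finset.sum_mul, w, mul_assoc] using this
    · intro j s u hu
      simp_rw [← map_smul]
      rw [← map_sum]
      convert map_zero S.mkQ
      have := congrArg (fun x => x * eT F d θ θs s * esT F d θ θs k)
        (esT_mul_pow_mul_esT (F := F) (d := d) (θ := θ) (θs := θs) (Or.inl hu))
      simpa [aT_pow, Finset.mul_sum, Finset.sum_mul, w, mul_assoc] using this
  by_cases hj : j ≤ d
  · rw [expand]
    refine Submodule.sum_mem _ fun r hr => Submodule.sum_mem _ fun s hs => S.smul_mem _ ?_
    rw [← Submodule.Quotient.mk_eq_zero]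
    exact hzero j hj r (Finset.mem_range_succ_iff.1 hr) s (Finset.mem_range_succ_iff.1 hs)
  · have : esT F d θ θs j = 0 := by simp only [esT]; rw [dif_neg (by omega)]
    simp [this]

end TAlgRelations

section ConvexVectors

variable {F : Type*} [Field F] {d : ℕ} {θ θs : ℕ → F} {M : Type*} [AddCommGroup M]
  [Module (TAlg F d θ θs) M]

/-- `ConvexVec ξ r k x` says that `x` has the form
`e*_r f_0(a) e*_{k_1} f_1(a) ⋯ e*_{k_m} f_m(a) ξ` where `(r, k_1, …, k_m, 0)` is convex and strictly
decreasing and `k` is its second entry. -/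
inductive ConvexVec (ξ : M) : ℕ → ℕ → M → Prop
  | base (r : ℕ) (hr : 1 ≤ r) (f : F[X]) :
      ConvexVec ξ r 0 ((esT F d θ θs r * aeval (aT F d θ θs) f) • ξ)
  | step (i j k : ℕ) (x : M) (hx : ConvexVec ξ j k x) (hik : 2 * j ≤ i + k) (f : F[X]) :
      ConvexVec ξ i j ((esT F d θ θs i * aeval (aT F d θ θs) f) • x)

theorem ConvexVec.lt {ξ : M} {i k : ℕ} {x : M}
    (hx : ConvexVec (F := F) (d := d) (θ := θ) (θs := θs) ξ i k x) : k < i := by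
  induction hx with
  | base r hr f => omega
  | step i j k x hx hik f ih => omega

theorem ConvexVec.esT_smul {ξ : M} {i k : ℕ} {x : M}
    (hx : ConvexVec (F := F) (d := d) (θ := θ) (θs := θs) ξ i k x) :
    esT F d θ θs i • x = x := by
  cases hx <;> rw [smul_smul, ← mul_assoc, esT_mul, if_pos rfl]

/-- The span of the vectors `e*_i ⋯ ξ` attached to convex sequences starting with `i`. -/
def convexSpan (F : Type*) [Field F] (d : ℕ) (θ θs : ℕ → F) {M : Type*} [AddCommGroup M]
    [Module F M] [Module (TAlg F d θ θs) M] (ξ : M) (i : ℕ) : Submodule F M :=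
  Submodule.span F
    {x | ∃ k, ConvexVec (F := F) (d := d) (θ := θ) (θs := θs) ξ i k x}

variable [Module F M] [IsScalarTower F (TAlg F d θ θs) M]

theorem esT_aeval_smul_mem_convexSpan (hθ : Set.InjOn θ (Finset.range (d + 1)))
    (hθs : Set.InjOn θs (Finset.range (d + 1))) {ξ : M} (hξ : esT F d θ θs 0 • ξ = ξ)
    (h0 : ∀ y : M, ∃ c : F, esT F d θ θs 0 • y = c • ξ) (j : ℕ) :
    ∀ i, 1 ≤ i → ∀ k x, ∀ f : F[X],
      ConvexVec (F := F) (d := d) (θ := θ) (θs := θs) ξ j k x →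
      (esT F d θ θs i * aeval (aT F d θ θs) f) • x ∈ convexSpan F d θ θs ξ i := by
  induction j using Nat.strong_induction_on with
  | _ j ih =>
  intro i hi k x f hx
  have hscalar : ∀ (f' : F[X]) (y : M),
      (esT F d θ θs i * aeval (aT F d θ θs) f') • esT F d θ θs 0 • y ∈
        convexSpan F d θ θs ξ i := by
    intro f' y
    obtain ⟨c, hc⟩ := h0 y
    rw [hc, smul_comm]
    exact Submodule.smul_mem _ _ (Submodule.subset_span ⟨0, ConvexVec.base i hi f'⟩)
  by_cases hgood : 2 * j ≤ i + k
  · exact Submodule.subset_span ⟨j, ConvexVec.step i j k x hx hgood f⟩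
  have reduce : ∀ (g : F[X]) (y : M), esT F d θ θs k • y = y →
      (∀ (j' : ℕ) (f' g' : F[X]), 1 ≤ j' → 2 * j' ≤ i + k →
        (esT F d θ θs i * aeval (aT F d θ θs) f') •
          (esT F d θ θs j' * aeval (aT F d θ θs) g') • y ∈ convexSpan F d θ θs ξ i) →
      (esT F d θ θs i * aeval (aT F d θ θs) f) •
        (esT F d θ θs j * aeval (aT F d θ θs) g) • y ∈ convexSpan F d θ θs ξ i := by
    intro g y hy H
    have hmem := Submodule.mem_map_of_mem (f := applyVec y)
      (esT_aeval_esT_aeval_esT_mem hθ hθs i j k f g)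
    rw [Submodule.map_span] at hmem
    have hrw : ∀ (j' : ℕ) (f' g' : F[X]),
        applyVec y (esT F d θ θs i * aeval (aT F d θ θs) f' * esT F d θ θs j' *
          aeval (aT F d θ θs) g' * esT F d θ θs k) =
        (esT F d θ θs i * aeval (aT F d θ θs) f') •
          (esT F d θ θs j' * aeval (aT F d θ θs) g') • y := by
      intro j' f' g'
      conv_rhs => rw [← hy]
      simp only [applyVec, LinearMap.coe_mk, AddHom.coe_mk, smul_smul, mul_assoc]
    rw [hrw] at hmem
    refine Submodule.span_le.2 ?_ hmem
    rintro _ ⟨_, ⟨j', f', g', hj', rfl⟩, rfl⟩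
    rw [hrw]
    rcases Nat.eq_zero_or_pos j' with rfl | hpos
    · rw [mul_smul (esT F d θ θs 0)]
      exact hscalar _ _
    · exact H j' f' g' hpos hj'
  cases hx with
  | base _ hj g =>
    exact reduce g ξ hξ fun j' f' g' hpos hj' => Submodule.subset_span
      ⟨j', ConvexVec.step i j' 0 _ (ConvexVec.base j' hpos g') hj' f'⟩
  | step _ _ l y hy hkl g =>
    have hlt := hy.lt
    refine reduce g y hy.esT_smul fun j' f' g' hpos hj' => ?_
    have hmem := ih k (by omega) j' hpos l y g' hy
    refine Submodule.span_induction (p := fun z _ =>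
      (esT F d θ θs i * aeval (aT F d θ θs) f') • z ∈ convexSpan F d θ θs ξ i)
      ?_ ?_ ?_ ?_ hmem
    · rintro z ⟨k', hz⟩
      exact ih j' (by omega) i hi k' z f' hz
    · rw [smul_zero]; exact Submodule.zero_mem _
    · intro z z' _ _ hz hz'
      rw [smul_add]; exact Submodule.add_mem _ hz hz'
    · intro c z _ hz
      rw [smul_comm]; exact Submodule.smul_mem _ _ hz

/-- `Fξ` together with all convex vectors spans a subspace stable under `T`; hence
`e*_r T ξ` is spanned by the convex vectors starting with `r`. -/
theorem esT_smul_mem_convexSpan (hθ : Set.InjOn θ (Finset.range (d + 1)))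
    (hθs : Set.InjOn θs (Finset.range (d + 1))) {ξ : M} (hξ : esT F d θ θs 0 • ξ = ξ)
    (h0 : ∀ y : M, ∃ c : F, esT F d θ θs 0 • y = c • ξ) {r : ℕ} (hr : 1 ≤ r)
    (t : TAlg F d θ θs) : esT F d θ θs r • t • ξ ∈ convexSpan F d θ θs ξ r := by
  set G : Set M := {x | x = ξ ∨ ∃ i k, ConvexVec (F := F) (d := d) (θ := θ) (θs := θs) ξ i k x}
  set N := Submodule.span F G with hN
  have hξN : ξ ∈ N := Submodule.subset_span (Or.inl rfl)
  have hconv : ∀ i, convexSpan F d θ θs ξ i ≤ N := fun i =>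
    Submodule.span_mono fun x ⟨k, hx⟩ => Or.inr ⟨i, k, hx⟩
  have lift : ∀ t : TAlg F d θ θs, (∀ y ∈ G, t • y ∈ N) → ∀ y ∈ N, t • y ∈ N := by
    intro t ht y hy
    refine Submodule.span_induction (p := fun z _ => t • z ∈ N) ht ?_ ?_ ?_ hy
    · rw [smul_zero]; exact N.zero_mem
    · intro z z' _ _ hz hz'
      rw [smul_add]; exact N.add_mem hz hz'
    · intro c z _ hz
      rw [smul_comm]; exact N.smul_mem _ hz
  have hes : ∀ i, ∀ y ∈ N, esT F d θ θs i • y ∈ N := by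
    intro i
    refine lift _ ?_
    rintro y (rfl | ⟨j, k, hy⟩)
    · rw [← hξ, smul_smul, esT_mul]
      split_ifs with h
      · rw [h, hξ]; exact hξN
      · rw [zero_smul]; exact N.zero_mem
    · rw [← hy.esT_smul, smul_smul, esT_mul]
      split_ifs with h
      · rw [h, hy.esT_smul]; exact Submodule.subset_span (Or.inr ⟨j, k, hy⟩)
      · rw [zero_smul]; exact N.zero_mem
  have hD : ∀ f : F[X], ∀ y ∈ N, aeval (aT F d θ θs) f • y ∈ N := by
    intro f
    refine lift _ fun y hy => ?_
    rw [← one_mul (aeval (aT F d θ θs) f), ← sum_esT, Finset.sum_mul, Finset.sum_smul]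
    refine Submodule.sum_mem _ fun i _ => ?_
    rcases Nat.eq_zero_or_pos i with rfl | hi
    · rw [mul_smul]
      obtain ⟨c, hc⟩ := h0 (aeval (aT F d θ θs) f • y)
      rw [hc]; exact N.smul_mem _ hξN
    · refine hconv i ?_
      rcases hy with rfl | ⟨j, k, hy⟩
      · exact Submodule.subset_span ⟨0, ConvexVec.base i hi f⟩
      · exact esT_aeval_smul_mem_convexSpan hθ hθs hξ h0 j i hi k y f hy
  have hT : ∀ t : TAlg F d θ θs, ∀ y ∈ N, t • y ∈ N := by
    intro t
    obtain ⟨w, rfl⟩ := RingQuot.mkAlgHom_surjective F (TRel F d θ θs) t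
    induction w using FreeAlgebra.induction with
    | grade0 c =>
      intro y hy
      rw [AlgHom.commutes, algebraMap_smul]
      exact N.smul_mem c hy
    | grade1 g =>
      intro y hy
      cases g with
      | a =>
        have := hD X y hy
        rwa [aeval_X] at this
      | astar =>
        change asT F d θ θs • y ∈ N
        rw [asT_eq_sum, Finset.sum_smul]
        refine Submodule.sum_mem _ fun i _ => ?_
        rw [smul_assoc]
        exact N.smul_mem _ (hes i y hy)
      | e i =>
        change tgen F d θ θs (TGen.e i) • y ∈ N
        obtain ⟨f, hf⟩ := eT_eq_aeval (θs := θs) hθ (i : ℕ)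
        rw [← eT_fin, hf]
        exact hD f y hy
      | estar i =>
        change tgen F d θ θs (TGen.estar i) • y ∈ N
        rw [← esT_fin]
        exact hes i y hy
    | mul p q hp hq =>
      intro y hy
      rw [map_mul, mul_smul]
      exact hp _ (hq y hy)
    | add p q hp hq =>
      intro y hy
      rw [map_add, add_smul]
      exact N.add_mem (hp y hy) (hq y hy)
  refine Submodule.span_induction (p := fun z _ => esT F d θ θs r • z ∈ convexSpan F d θ θs ξ r)
    ?_ ?_ ?_ ?_ (hT t ξ hξN)
  · rintro z (rfl | ⟨j, k, hz⟩)
    · rw [← hξ, smul_smul, esT_mul, if_neg (by omega), zero_smul]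
      exact Submodule.zero_mem _
    · by_cases hjr : r = j
      · subst hjr
        rw [hz.esT_smul]; exact Submodule.subset_span ⟨k, hz⟩
      · rw [← hz.esT_smul, smul_smul, esT_mul, if_neg hjr, zero_smul]
        exact Submodule.zero_mem _
  · rw [smul_zero]; exact Submodule.zero_mem _
  · intro z z' _ _ hz hz'
    rw [smul_add]; exact Submodule.add_mem _ hz hz'
  · intro c z _ hz
    rw [smul_comm]; exact Submodule.smul_mem _ _ hz

theorem esChain_cons (i j : ℕ) {κ κ' : ℕ → ℕ} (h1 : κ' 1 = j)
    (hs : ∀ l, 1 ≤ l → κ' (l + 1) = κ l) (m : ℕ) :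
    Submodule.span F {esT F d θ θs i} * Dsub F d θ θs * esChain F d θ θs j κ m =
      esChain F d θ θs i κ' (m + 1) := by
  induction m with
  | zero => simp only [esChain, zero_add, h1]
  | succ m ih =>
    rw [esChain, esChain, ← ih, hs (m + 1) (by omega)]
    simp only [mul_assoc]

theorem ConvexVec.exists_esChain {ξ : M} {r k : ℕ} {x : M}
    (hx : ConvexVec (F := F) (d := d) (θ := θ) (θs := θs) ξ r k x) :
    ∃ (m : ℕ) (κ : ℕ → ℕ), ((1 ≤ m → κ 1 < r) ∧ (∀ i, 1 ≤ i → i + 1 ≤ m → κ (i + 1) < κ i) ∧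
      (∀ i, 1 ≤ i → i ≤ m → 0 < κ i) ∧
      ConvexSeq (fun i => if i = 0 then (r : ℤ) else if i ≤ m then (κ i : ℤ) else 0) (m + 1)) ∧
      (1 ≤ m → κ 1 = k) ∧ (m = 0 → k = 0) ∧
      x ∈ Submodule.map (applyVec ξ) (esChain F d θ θs r κ m * Dsub F d θ θs) := by
  induction hx with
  | base r hr f =>
    refine ⟨0, fun _ => 0, ⟨by omega, by omega, by omega, fun i _ _ => by omega⟩, by omega,
      fun _ => rfl, _, Submodule.mul_mem_mul (Submodule.mem_span_singleton_self _)
        (mem_Dsub.2 ⟨f, rfl⟩), rfl⟩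
  | step i j k x hx hik f ih =>
    have hlt := hx.lt
    obtain ⟨m, κ, ⟨h1, h2, h3, h4⟩, h5, h6, t, ht, rfl⟩ := ih
    have hκ : ∀ l, 1 ≤ l → (fun n => if n ≤ 1 then j else κ (n - 1)) (l + 1) = κ l := by
      intro l hl
      simp only [add_tsub_cancel_right]
      rw [if_neg (by omega)]
    refine ⟨m + 1, fun n => if n ≤ 1 then j else κ (n - 1), ⟨?_, ?_, ?_, ?_⟩, ?_, ?_, ?_⟩
    · intro _
      simp only [le_refl, if_true]
      omega
    · intro l hl hlm
      rw [hκ l hl]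
      obtain rfl | hl' : l = 1 ∨ 2 ≤ l := by omega
      · simpa using h1 (by omega)
      · obtain ⟨n, rfl⟩ : ∃ n, l = n + 1 := ⟨l - 1, by omega⟩
        rw [hκ n (by omega)]
        exact h2 n (by omega) (by omega)
    · intro l hl hlm
      obtain rfl | hl' : l = 1 ∨ 2 ≤ l := by omega
      · simp only [le_refl, if_true]; omega
      · obtain ⟨n, rfl⟩ : ∃ n, l = n + 1 := ⟨l - 1, by omega⟩
        rw [hκ n (by omega)]
        exact h3 n (by omega) (by omega)
    · intro l hl hlm
      obtain rfl | hl' : l = 1 ∨ 2 ≤ l := by omega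
      · rcases Nat.eq_zero_or_pos m with rfl | hm
        · have := h6 rfl
          simp; omega
        · have := h5 hm
          simp [this, show 2 ≤ m + 1 by omega]; omega
      · obtain ⟨n, rfl⟩ : ∃ n, l = n + 2 := ⟨l - 2, by omega⟩
        have := h4 (n + 1) (by omega) (by omega)
        rcases Nat.eq_zero_or_pos n with rfl | hn
        · simpa [add_assoc] using this
        · simpa [add_assoc, hn.ne'] using this
    · simp
    · omega
    · rw [← esChain_cons i j (κ := κ) (by simp) hκ m, mul_assoc]
      refine ⟨esT F d θ θs i * aeval (aT F d θ θs) f * t, Submodule.mul_mem_mul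
        (Submodule.mul_mem_mul (Submodule.mem_span_singleton_self _) (mem_Dsub.2 ⟨f, rfl⟩)) ht, ?_⟩
      simp only [applyVec, LinearMap.coe_mk, AddHom.coe_mk, mul_smul]

theorem esT_mul_of_mem_esChain {r : ℕ} {κ : ℕ → ℕ} {m : ℕ} {x : TAlg F d θ θs}
    (hx : x ∈ esChain F d θ θs r κ m) : esT F d θ θs r * x = x := by
  have mul : ∀ (p q : Submodule F (TAlg F d θ θs)), (∀ x ∈ p, esT F d θ θs r * x = x) →
      ∀ x ∈ p * q, esT F d θ θs r * x = x := by
    intro p q hp x hx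
    refine Submodule.mul_induction_on hx (fun y hy z _ => by rw [← mul_assoc, hp y hy])
      fun y z hy hz => by rw [mul_add, hy, hz]
  induction m generalizing x with
  | zero =>
    obtain ⟨c, rfl⟩ := Submodule.mem_span_singleton.1 hx
    rw [mul_smul_comm, esT_mul, if_pos rfl]
  | succ m ih => exact mul _ _ (mul _ _ fun y hy => ih hy) x hx

/-- Surjectivity of `μ` forces `e*_0 T ξ` to be spanned by `ξ` when the `g_i` annihilate `ξ`. -/
theorem esT_zero_smul_eq_smul {ζ : ℕ → F} {μ : MvPolynomial (Fin d) F →ₗ[F] TAlg F d θ θs}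
    (hμ : MuProps F d θ θs μ) {ξ : M} (hξ : esT F d θ θs 0 • ξ = ξ)
    (hg : ∀ i ∈ Set.Icc 1 d, gElt F d θ θs ζ i • ξ = 0) (t : TAlg F d θ θs) :
    ∃ c : F, esT F d θ θs 0 • t • ξ = c • ξ := by
  obtain ⟨h1, hmul, hX, hrange⟩ := hμ
  have scalar : ∀ p, ∃ c : F, μ p • ξ = c • ξ := by
    intro p
    induction p using MvPolynomial.induction_on with
    | C b =>
      refine ⟨b, ?_⟩
      rw [← mul_one (MvPolynomial.C b), MvPolynomial.C_mul', map_smul, h1, smul_assoc, hξ]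
    | add p q hp hq =>
      obtain ⟨b, hb⟩ := hp
      obtain ⟨c, hc⟩ := hq
      exact ⟨b + c, by rw [map_add, add_smul, add_smul, hb, hc]⟩
    | mul_X p i hp =>
      obtain ⟨b, hb⟩ := hp
      refine ⟨(ζ (i + 1) / ∏ h ∈ Finset.Icc 1 ((i : ℕ) + 1), (θs 0 - θs h)) * b, ?_⟩
      have hgi := hg (i + 1) ⟨by omega, by omega⟩
      rw [gElt, sub_smul, sub_eq_zero, smul_assoc, hξ] at hgi
      rw [hmul, mul_smul, hX, hgi, smul_comm, hb, smul_smul]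
  have hmem : esT F d θ θs 0 * (t * esT F d θ θs 0) ∈ LinearMap.range μ := by
    rw [hrange]; exact ⟨t, rfl⟩
  obtain ⟨p, hp⟩ := hmem
  obtain ⟨c, hc⟩ := scalar p
  exact ⟨c, by rw [← hc, hp, mul_smul, mul_smul, hξ]⟩

end ConvexVectors

theorem mk_eq_smul_mk_one {R : Type*} [Ring R] (I : Submodule R R) (t : R) :
    (Submodule.Quotient.mk t : R ⧸ I) = t • Submodule.Quotient.mk 1 := by
  rw [← Submodule.Quotient.mk_smul, smul_eq_mul, mul_one]

/-- If `μ` is an isomorphism then for `1 ≤ r ≤ d`, the `F`-vector space `e*_r M` equals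
`Σ e*_r D e*_{k_1} D e*_{k_2} ⋯ D e*_{k_m} D ξ`, summed over all sequences `(k_1, …, k_m)`
(`m ≥ 0`) with `r > k_1 > ⋯ > k_m > 0` such that `(r, k_1, …, k_m, 0)` is convex. -/
theorem stmt10 {F : Type*} [Field F] (d : ℕ) (θ θs : ℕ → F) (h : EigCond F d θ θs)
    (μ : MvPolynomial (Fin d) F →ₗ[F] TAlg F d θ θs) (hμ : MuProps F d θ θs μ)
    (hinj : Function.Injective μ)
    (ζ : ℕ → F) (hζ : ZetaCond F d θ θs ζ)
    (r : ℕ) (hr1 : 1 ≤ r) (hrd : r ≤ d) :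
    LinearMap.range (actL (M := TAlg F d θ θs ⧸ Jideal F d θ θs ζ) (esT F d θ θs r)) =
      ⨆ m : ℕ, ⨆ κ : ℕ → ℕ,
        ⨆ _ : ((1 ≤ m → κ 1 < r) ∧ (∀ i, 1 ≤ i → i + 1 ≤ m → κ (i + 1) < κ i) ∧
          (∀ i, 1 ≤ i → i ≤ m → 0 < κ i) ∧
          ConvexSeq (fun i => if i = 0 then (r : ℤ) else if i ≤ m then (κ i : ℤ) else 0)
            (m + 1)),
        Submodule.map
          (applyVec (Submodule.Quotient.mk (1 : TAlg F d θ θs) :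
            TAlg F d θ θs ⧸ Jideal F d θ θs ζ))
          (esChain F d θ θs r κ m * Dsub F d θ θs) := by
  have hθ : Set.InjOn θ (Finset.range (d + 1)) := fun i hi j hj hij => by
    by_contra hne
    simp only [Finset.coe_range, Set.mem_Iio] at hi hj
    exact h.1 i j (by omega) (by omega) hne hij
  have hθs : Set.InjOn θs (Finset.range (d + 1)) := fun i hi j hj hij => by
    by_contra hne
    simp only [Finset.coe_range, Set.mem_Iio] at hi hj
    exact h.2.1 i j (by omega) (by omega) hne hij
  apply le_antisymm
  · rintro _ ⟨y, rfl⟩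
    obtain ⟨t, rfl⟩ := Submodule.Quotient.mk_surjective _ y
    set ξ : TAlg F d θ θs ⧸ Jideal F d θ θs ζ := Submodule.Quotient.mk 1 with hξdef
    have hξ : esT F d θ θs 0 • ξ = ξ := by
      rw [hξdef, ← mk_eq_smul_mk_one, eq_comm, Submodule.Quotient.eq]
      exact Submodule.subset_span (Or.inl rfl)
    have hg : ∀ i ∈ Set.Icc 1 d, gElt F d θ θs ζ i • ξ = 0 := fun i hi => by
      rw [hξdef, ← mk_eq_smul_mk_one, Submodule.Quotient.mk_eq_zero]
      exact Submodule.subset_span (Or.inr ⟨i, hi, rfl⟩)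
    have hmem := esT_smul_mem_convexSpan hθ hθs hξ (fun y => by
      obtain ⟨u, rfl⟩ := Submodule.Quotient.mk_surjective _ y
      rw [mk_eq_smul_mk_one]
      exact esT_zero_smul_eq_smul hμ hξ hg u) hr1 t
    rw [mk_eq_smul_mk_one]
    refine Submodule.span_le.2 ?_ hmem
    rintro x ⟨k, hx⟩
    obtain ⟨m, κ, hκ, -, -, hxm⟩ := hx.exists_esChain
    exact Submodule.mem_iSup_of_mem m (Submodule.mem_iSup_of_mem κ
      (Submodule.mem_iSup_of_mem hκ hxm))
  · refine iSup_le fun m => iSup_le fun κ => iSup_le fun _ => ?_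
    rintro _ ⟨t, ht, rfl⟩
    have hrt : esT F d θ θs r * t = t :=
      Submodule.mul_induction_on ht
        (fun y hy z _ => by rw [← mul_assoc, esT_mul_of_mem_esChain hy])
        fun y z hy hz => by rw [mul_add, hy, hz]
    refine ⟨applyVec (Submodule.Quotient.mk 1) t, ?_⟩
    conv_rhs => rw [← hrt]
    simp only [actL, applyVec, LinearMap.coe_mk, AddHom.coe_mk, mul_smul]
end

section
/- Assume that μ is an isomorphism. For 0 ≤ i ≤ d, the elements e*_0 τ_i(a) e*_0 and ζ_i e*_0 / ((θ*_0−θ*_1)(θ*_0−θ*_2)⋯(θ*_0−θ*_i)) of T act identically on the T-module M. -/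
open Polynomial

/-- The properties of `μ` force `e*_0` to be idempotent. -/
theorem MuProps.isIdempotentElem_esT {F : Type*} [Field F] {d : ℕ} {θ θs : ℕ → F}
    {μ : MvPolynomial (Fin d) F →ₗ[F] TAlg F d θ θs} (hμ : MuProps F d θ θs μ) :
    esT F d θ θs 0 * esT F d θ θs 0 = esT F d θ θs 0 := by
  obtain ⟨h1, hmul, -⟩ := hμ
  rw [← h1, ← hmul, mul_one]

/-- The properties of `μ` force `e*_0 T e*_0` to be commutative. -/
theorem MuProps.mul_comm_of_mem_corner {F : Type*} [Field F] {d : ℕ} {θ θs : ℕ → F}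
    {μ : MvPolynomial (Fin d) F →ₗ[F] TAlg F d θ θs} (hμ : MuProps F d θ θs μ)
    {x y : TAlg F d θ θs} (hx : x ∈ corner F d θ θs) (hy : y ∈ corner F d θ θs) :
    x * y = y * x := by
  obtain ⟨-, hmul, -, hrange⟩ := hμ
  rw [← hrange] at hx hy
  obtain ⟨p, rfl⟩ := hx
  obtain ⟨q, rfl⟩ := hy
  rw [← hmul, ← hmul, mul_comm]

/-- Every element `e*_0 t e*_0` lies in `e*_0 T e*_0`. -/
theorem esT_mul_mul_esT_mem_corner {F : Type*} [Field F] {d : ℕ} {θ θs : ℕ → F}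
    (t : TAlg F d θ θs) :
    esT F d θ θs 0 * t * esT F d θ θs 0 ∈ corner F d θ θs :=
  ⟨t, by simp [mul_assoc]⟩

/-- For `1 ≤ i ≤ d`, the left ideal `J` contains the right ideal `g_i T`. -/
theorem gElt_mul_mem_Jideal {F : Type*} [Field F] {d : ℕ} {θ θs : ℕ → F}
    {μ : MvPolynomial (Fin d) F →ₗ[F] TAlg F d θ θs} (hμ : MuProps F d θ θs μ) (ζ : ℕ → F)
    {i : ℕ} (hi : i ∈ Set.Icc 1 d) (t : TAlg F d θ θs) :
    gElt F d θ θs ζ i * t ∈ Jideal F d θ θs ζ := by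
  set e := esT F d θ θs 0 with he
  set g := gElt F d θ θs ζ i with hg
  have hee : e * e = e := hμ.isIdempotentElem_esT
  have hge : g * e = g := by
    rw [hg, gElt, ← he, sub_mul, mul_assoc _ e e, hee, smul_mul_assoc, hee]
  have hgc : g ∈ corner F d θ θs := by
    refine Submodule.sub_mem _ (esT_mul_mul_esT_mem_corner _) (Submodule.smul_mem _ _ ?_)
    simpa [← he, hee] using esT_mul_mul_esT_mem_corner (1 : TAlg F d θ θs)
  have hsplit : g * t = (g * t) * (1 - e) + (e * t * e) * g := by
    rw [hμ.mul_comm_of_mem_corner (esT_mul_mul_esT_mem_corner t) hgc, mul_assoc e t e,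
      ← mul_assoc g e, hge, mul_sub, mul_one, mul_assoc g t e, sub_add_cancel]
  rw [hsplit]
  exact Submodule.add_mem _
    (Submodule.smul_mem _ _ (Submodule.subset_span (Or.inl rfl)))
    (Submodule.smul_mem _ _ (Submodule.subset_span (Or.inr ⟨i, hi, rfl⟩)))

/-- If `μ` is an isomorphism then for `0 ≤ i ≤ d`, the elements `e*_0 τ_i(a) e*_0` and
`ζ_i e*_0 / ((θ*_0−θ*_1)⋯(θ*_0−θ*_i))` of `T` act identically on `M = T/J`. -/
theorem stmt12 {F : Type*} [Field F] (d : ℕ) (θ θs : ℕ → F) (h : EigCond F d θ θs)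
    (μ : MvPolynomial (Fin d) F →ₗ[F] TAlg F d θ θs) (hμ : MuProps F d θ θs μ)
    (hinj : Function.Injective μ)
    (ζ : ℕ → F) (hζ : ZetaCond F d θ θs ζ) :
    ∀ i, i ≤ d → ∀ m : TAlg F d θ θs ⧸ Jideal F d θ θs ζ,
      (esT F d θ θs 0 * (Polynomial.aeval (aT F d θ θs) (tauPoly θ i)) *
        esT F d θ θs 0) • m =
      ((ζ i / ∏ h ∈ Finset.Icc 1 i, (θs 0 - θs h)) • esT F d θ θs 0) • m := by
  intro i hi m
  obtain ⟨t, rfl⟩ := Submodule.Quotient.mk_surjective _ m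
  rcases Nat.eq_zero_or_pos i with rfl | hpos
  · simp [tauPoly, hζ.1, hμ.isIdempotentElem_esT]
  · refine (Submodule.Quotient.eq _).2 ?_
    have hmem := gElt_mul_mem_Jideal hμ ζ ⟨hpos, hi⟩ t
    rw [gElt, sub_mul] at hmem
    exact hmem
end

section
/- Assume that μ is an isomorphism. Let V denote a proper T-submodule of M (that is, a T-submodule with V ≠ M). Then e*_0 V = 0. -/
open Polynomial

/-- Modulo the left ideal `J`, the image of `μ` consists of scalars: `μ p ≡ c` for some `c ∈ F`. -/
lemma exists_map_sub_smul_one_mem_Jideal {F : Type*} [Field F] {d : ℕ} {θ θs : ℕ → F}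
    {μ : MvPolynomial (Fin d) F →ₗ[F] TAlg F d θ θs} (hμ : MuProps F d θ θs μ)
    (ζ : ℕ → F) (p : MvPolynomial (Fin d) F) :
    ∃ c : F, μ p - c • (1 : TAlg F d θ θs) ∈ Jideal F d θ θs ζ := by
  obtain ⟨hone, hmul, hX, -⟩ := hμ
  have hsmul (r : F) (x y : TAlg F d θ θs) (hxy : x - y ∈ Jideal F d θ θs ζ) :
      r • x - r • y ∈ Jideal F d θ θs ζ :=
    (show r • (x - y) = r • x - r • y from smul_sub r x y) ▸ Submodule.smul_of_tower_mem _ r hxy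
  induction p using MvPolynomial.induction_on with
  | C r =>
    refine ⟨r, ?_⟩
    have he : 1 - esT F d θ θs 0 ∈ Jideal F d θ θs ζ := Submodule.subset_span (Or.inl rfl)
    have hC : μ (MvPolynomial.C r) = r • esT F d θ θs 0 := by
      rw [← hone, ← map_smul, MvPolynomial.smul_eq_C_mul, mul_one]
    rw [hC]
    exact hsmul r _ _ (sub_mem_comm_iff.1 he)
  | add p q hp hq =>
    obtain ⟨b, hb⟩ := hp
    obtain ⟨c, hc⟩ := hq
    refine ⟨b + c, ?_⟩
    rw [map_add, add_smul, add_sub_add_comm]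
    exact add_mem hb hc
  | mul_X p i hp =>
    obtain ⟨c, hc⟩ := hp
    set z : F := ζ ((i : ℕ) + 1) / ∏ h ∈ Finset.Icc 1 ((i : ℕ) + 1), (θs 0 - θs h) with hz
    refine ⟨z * c, ?_⟩
    have hg : gElt F d θ θs ζ ((i : ℕ) + 1) ∈ Jideal F d θ θs ζ :=
      Submodule.subset_span (Or.inr ⟨_, ⟨by omega, by omega⟩, rfl⟩)
    have hXg : μ (MvPolynomial.X i) = gElt F d θ θs ζ ((i : ℕ) + 1) + z • esT F d θ θs 0 := by
      rw [hX, gElt, ← hz, sub_add_cancel]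
    have hpe : μ p * esT F d θ θs 0 = μ p := by rw [← hone, ← hmul, mul_one]
    rw [hmul, hXg, mul_add, mul_smul_comm, hpe, mul_smul, add_sub_assoc]
    exact add_mem (Submodule.smul_mem _ (μ p) hg) (hsmul z _ _ hc)

/-- If `μ` is an isomorphism then every proper `T`-submodule `V` of `M = T/J`
satisfies `e*_0 V = 0`. -/
theorem stmt14 {F : Type*} [Field F] (d : ℕ) (θ θs : ℕ → F) (h : EigCond F d θ θs)
    (μ : MvPolynomial (Fin d) F →ₗ[F] TAlg F d θ θs) (hμ : MuProps F d θ θs μ)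
    (hinj : Function.Injective μ)
    (ζ : ℕ → F) (hζ : ZetaCond F d θ θs ζ)
    (V : Submodule (TAlg F d θ θs) (TAlg F d θ θs ⧸ Jideal F d θ θs ζ)) (hV : V ≠ ⊤) :
    ∀ v ∈ V, esT F d θ θs 0 • v = 0 := by
  intro v hv
  obtain ⟨t, rfl⟩ := Submodule.Quotient.mk_surjective _ v
  set e := esT F d θ θs 0
  have he : 1 - e ∈ Jideal F d θ θs ζ := Submodule.subset_span (Or.inl rfl)
  obtain ⟨p, hp⟩ : e * (t * e) ∈ LinearMap.range μ := by
    rw [hμ.2.2.2]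
    exact ⟨t, rfl⟩
  obtain ⟨c, hc⟩ := exists_map_sub_smul_one_mem_Jideal hμ ζ p
  have key : e * t - c • (1 : TAlg F d θ θs) ∈ Jideal F d θ θs ζ := by
    have hsplit : e * t - c • (1 : TAlg F d θ θs) =
        (e * t) * (1 - e) + (μ p - c • (1 : TAlg F d θ θs)) := by
      rw [hp, mul_sub, mul_one, mul_assoc]
      abel
    rw [hsplit]
    exact add_mem (Submodule.smul_mem _ (e * t) he) hc
  have hmk : e • Submodule.Quotient.mk (p := Jideal F d θ θs ζ) t =
      Submodule.Quotient.mk (c • (1 : TAlg F d θ θs)) :=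
    (Submodule.Quotient.eq _).2 key
  by_cases hc0 : c = 0
  · rw [hmk, hc0, zero_smul, Submodule.Quotient.mk_zero]
  · refine absurd (Submodule.eq_top_iff'.2 fun w => ?_) hV
    obtain ⟨s, rfl⟩ := Submodule.Quotient.mk_surjective _ w
    have hw := V.smul_mem (c⁻¹ • s) (V.smul_mem e hv)
    rwa [hmk, ← Submodule.Quotient.mk_smul, smul_eq_mul, smul_mul_smul_comm, inv_mul_cancel₀ hc0,
      one_smul, mul_one] at hw
end

section
/- Assume that μ is an isomorphism. Then there exists a unique maximal proper T-submodule of M, where a proper T-submodule V of M is called maximal whenever V is not contained in any proper T-submodule of M besides itself. -/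
open Polynomial

/-- If an element `e` congruent to `1` modulo a proper left ideal `J` acts on `A ⧸ J` with image
in the line spanned by the class of `1`, then `A ⧸ J` has a unique maximal proper submodule. -/
theorem existsUnique_maximal_submodule_quotient {F A : Type*} [Field F] [Ring A] [Algebra F A]
    (J : Submodule A A) (e : A) (he : 1 - e ∈ J) (hJ : (1 : A) ∉ J)
    (hline : ∀ t : A, ∃ c : F, e * t - c • (1 : A) ∈ J) :
    ∃! N : Submodule A (A ⧸ J), N ≠ ⊤ ∧ ∀ N' : Submodule A (A ⧸ J), N' ≠ ⊤ → N ≤ N' → N = N' := by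
  let N₀ : Submodule A (A ⧸ J) :=
    { carrier := {m | ∀ t : A, e • t • m = 0}
      add_mem' := fun {x y} hx hy t => by rw [smul_add, smul_add, hx t, hy t, add_zero]
      zero_mem' := fun t => by rw [smul_zero, smul_zero]
      smul_mem' := fun c x hx t => by rw [← mul_smul t c x]; exact hx (t * c) }
  have one_notMem {N : Submodule A (A ⧸ J)} (hN : N ≠ ⊤) : J.mkQ 1 ∉ N := fun h1 => hN <| by
    rw [eq_top_iff]
    rintro m -
    obtain ⟨t, rfl⟩ := J.mkQ_surjective m
    rw [← mul_one t, ← smul_eq_mul, map_smul]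
    exact N.smul_mem t h1
  have le_N₀ {N : Submodule A (A ⧸ J)} (hN : N ≠ ⊤) : N ≤ N₀ := by
    intro m hm t
    have hm' : e • t • m ∈ N := N.smul_mem e (N.smul_mem t hm)
    obtain ⟨s, hs⟩ := J.mkQ_surjective (t • m)
    obtain ⟨c, hc⟩ := hline s
    have key : e • t • m = algebraMap F A c • J.mkQ 1 := by
      rw [← hs, ← map_smul, ← map_smul, ← sub_eq_zero, ← map_sub, Submodule.mkQ_apply,
        Submodule.Quotient.mk_eq_zero]
      simpa [Algebra.smul_def] using hc
    by_cases h0 : c = 0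
    · rw [key, h0, map_zero, zero_smul]
    · refine absurd ?_ (one_notMem hN)
      have h1 := N.smul_mem (algebraMap F A c⁻¹) (key ▸ hm')
      rwa [smul_smul, ← map_mul, inv_mul_cancel₀ h0, map_one, one_smul] at h1
  have N₀_ne_top : N₀ ≠ ⊤ := fun htop => by
    have h1 : J.mkQ 1 ∈ N₀ := htop ▸ Submodule.mem_top
    have h2 : e • (1 : A) • J.mkQ 1 = 0 := h1 1
    rw [one_smul, ← map_smul, smul_eq_mul, mul_one, Submodule.mkQ_apply,
      Submodule.Quotient.mk_eq_zero] at h2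
    exact hJ (by simpa using J.add_mem he h2)
  exact ⟨N₀, ⟨N₀_ne_top, fun N' hN' hle => le_antisymm hle (le_N₀ hN')⟩,
    fun N hN => hN.2 N₀ N₀_ne_top (le_N₀ hN.1)⟩

/-- If `μ` is an isomorphism then `M = T/J` has a unique maximal proper `T`-submodule,
where a proper submodule is maximal whenever it is not contained in any proper submodule
of `M` besides itself. -/
theorem stmt15 {F : Type*} [Field F] (d : ℕ) (θ θs : ℕ → F) (h : EigCond F d θ θs)
    (μ : MvPolynomial (Fin d) F →ₗ[F] TAlg F d θ θs) (hμ : MuProps F d θ θs μ)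
    (hinj : Function.Injective μ)
    (ζ : ℕ → F) (hζ : ZetaCond F d θ θs ζ) :
    ∃! N : Submodule (TAlg F d θ θs) (TAlg F d θ θs ⧸ Jideal F d θ θs ζ),
      N ≠ ⊤ ∧ ∀ N' : Submodule (TAlg F d θ θs) (TAlg F d θ θs ⧸ Jideal F d θ θs ζ),
        N' ≠ ⊤ → N ≤ N' → N = N' := by
  obtain ⟨hμ1, hmul, hX, hrange⟩ := hμ
  set e := esT F d θ θs 0 with he
  set J := Jideal F d θ θs ζ
  have hee : e * e = e := by rw [← hμ1, ← hmul, one_mul]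
  let c : Fin d → F := fun i => ζ (i + 1) / ∏ h ∈ Finset.Icc 1 ((i : ℕ) + 1), (θs 0 - θs h)
  have hg (i : Fin d) : gElt F d θ θs ζ (i + 1) = μ (MvPolynomial.X i - MvPolynomial.C (c i)) := by
    rw [map_sub, hX, ← mul_one (MvPolynomial.C (c i)), ← MvPolynomial.smul_eq_C_mul, map_smul, hμ1]
    rfl
  have hcorner (t : TAlg F d θ θs) : ∃ p, μ p = e * t * e := by
    have : e * t * e ∈ LinearMap.range μ := by
      rw [hrange]
      exact ⟨t, by simp [he, mul_assoc]⟩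
    exact this
  have hone_sub : 1 - e ∈ J := Submodule.subset_span (Or.inl rfl)
  have hgmem (i : Fin d) : μ (MvPolynomial.X i - MvPolynomial.C (c i)) ∈ J := by
    rw [← hg]
    exact Submodule.subset_span (Or.inr ⟨i + 1, ⟨by omega, i.isLt⟩, rfl⟩)
  have heval (p : MvPolynomial (Fin d) F) : μ p - MvPolynomial.eval c p • e ∈ J := by
    induction p using MvPolynomial.induction_on with
    | C a =>
      rw [MvPolynomial.eval_C, ← mul_one (MvPolynomial.C a), ← MvPolynomial.smul_eq_C_mul,
        map_smul, hμ1, sub_self]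
      exact J.zero_mem
    | add p q hp hq =>
      convert J.add_mem hp hq using 1
      rw [map_add, map_add, add_smul]
      abel
    | mul_X p i hp =>
      convert J.add_mem (J.smul_mem (μ p) (hgmem i)) (J.smul_of_tower_mem (c i) hp) using 1
      have hsplit : p * MvPolynomial.X i =
          p * (MvPolynomial.X i - MvPolynomial.C (c i)) + c i • p := by
        rw [MvPolynomial.smul_eq_C_mul]
        ring
      rw [smul_eq_mul, ← hmul, hsplit, map_add, map_smul, ← hsplit, RingHom.map_mul,
        MvPolynomial.eval_X, smul_sub, smul_smul, mul_comm (c i)]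
      abel
  have hker {t : TAlg F d θ θs} (ht : t ∈ J) :
      ∃ p, MvPolynomial.eval c p = 0 ∧ e * t * e = μ p := by
    suffices H : ∀ s, ∃ p, MvPolynomial.eval c p = 0 ∧ e * (s * t) * e = μ p by
      simpa using H 1
    induction ht using Submodule.span_induction with
    | mem x hx =>
      intro s
      rcases hx with rfl | ⟨i, ⟨hi1, hid⟩, rfl⟩
      · refine ⟨0, map_zero _, ?_⟩
        rw [map_zero, mul_assoc, mul_assoc, sub_mul, one_mul, hee, sub_self, mul_zero, mul_zero]
      · obtain ⟨j, rfl⟩ : ∃ j : Fin d, i = j + 1 := ⟨⟨i - 1, by omega⟩, by simp; omega⟩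
        obtain ⟨p, hp⟩ := hcorner s
        refine ⟨p * (MvPolynomial.X j - MvPolynomial.C (c j)), by simp, ?_⟩
        rw [hg, hmul, hp]
        have hl (q) : e * μ q = μ q := by rw [← hμ1, ← hmul, one_mul]
        have hr (q) : μ q * e = μ q := by rw [← hμ1, ← hmul, mul_one]
        simp only [mul_assoc, hl, hr]
    | zero => exact fun s => ⟨0, map_zero _, by simp⟩
    | add x y _ _ hx hy =>
      intro s
      obtain ⟨p, hp, hp'⟩ := hx s
      obtain ⟨q, hq, hq'⟩ := hy s
      exact ⟨p + q, by rw [map_add, hp, hq, add_zero],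
        by rw [map_add, ← hp', ← hq', mul_add, mul_add, add_mul]⟩
    | smul a x _ hx =>
      intro s
      simpa [mul_assoc] using hx (s * a)
  refine existsUnique_maximal_submodule_quotient (F := F) J e hone_sub ?_ ?_
  · intro h1
    obtain ⟨p, hp, hp'⟩ := hker h1
    rw [mul_one, hee, ← hμ1] at hp'
    rw [← hinj hp', map_one] at hp
    exact one_ne_zero hp
  · intro t
    obtain ⟨p, hp⟩ := hcorner t
    refine ⟨MvPolynomial.eval c p, ?_⟩
    convert J.sub_mem (J.add_mem (J.smul_mem (e * t) hone_sub) (heval p))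
      (J.smul_of_tower_mem (MvPolynomial.eval c p) hone_sub) using 1
    rw [hp, smul_eq_mul, mul_sub, mul_one, smul_sub]
    abel
end
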